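/- arXiv:1410.2405 — 2 statements merged into one kernel-verified Lean document; each statement's English description precedes it below -/
import Mathlib

section
/- Let G be a finite simple graph and let t ≥ s ≥ 2 be integers. Then gn(G,t) ≥ (⌊log_s t⌋ / log_s t) · gn(G,s). -/
/-- A guessing strategy on graph `G` with alphabet `A`: each player `v` maps the
values of its neighbours to a guess of its own value. -/
def GuessStrategy {V : Type*} (G : SimpleGraph V) (A : Type*) : Type _ :=
  ∀ v : V, ((G.neighborSet v) → A) → A

/-- An assignment `a : V → A` is winning for the strategy `F` if every player
guesses its own value correctly. -/
def WinningAssignment {V : Type*} {G : SimpleGraph V} {A : Type*}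
    (F : GuessStrategy G A) (a : V → A) : Prop :=
  ∀ v : V, F v (fun u => a u.1) = a v

/-- The number of assignments won by strategy `F` in the game `(G, s)`. -/
noncomputable def winCount {V : Type*} (G : SimpleGraph V) (s : ℕ)
    (F : GuessStrategy G (Fin s)) : ℕ :=
  Nat.card {a : V → Fin s // WinningAssignment F a}

/-- `N(G,s)`: the maximum number of winning assignments over all strategies. -/
noncomputable def maxWinCount {V : Type*} (G : SimpleGraph V) (s : ℕ) : ℕ :=
  sSup {n | ∃ F : GuessStrategy G (Fin s), winCount G s F = n}

/-- The guessing number `gn(G,s) = log_s N(G,s)`. -/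
noncomputable def gn {V : Type*} (G : SimpleGraph V) (s : ℕ) : ℝ :=
  Real.logb s (maxWinCount G s)

/-- The `t`-uniform blowup of `G`. -/
def blowup {V : Type*} (G : SimpleGraph V) (t : ℕ) : SimpleGraph (V × Fin t) :=
  G.comap Prod.fst

/-- The numbers of winning assignments of the strategies of a finite game are bounded. -/
lemma bddAbove_winCount {V : Type*} [Finite V] (G : SimpleGraph V) (s : ℕ) :
    BddAbove {n | ∃ F : GuessStrategy G (Fin s), winCount G s F = n} := by
  refine ⟨Nat.card (V → Fin s), ?_⟩
  rintro _ ⟨F, rfl⟩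
  exact Nat.card_le_card_of_injective _ Subtype.val_injective

/-- Over a nonempty alphabet, some strategy attains the maximum. -/
lemma exists_winCount_eq_maxWinCount {V : Type*} [Finite V] (G : SimpleGraph V) {s : ℕ}
    (hs : 0 < s) : ∃ F : GuessStrategy G (Fin s), winCount G s F = maxWinCount G s :=
  Nat.sSup_mem (s := {n | ∃ F : GuessStrategy G (Fin s), winCount G s F = n})
    ⟨_, fun _ _ => ⟨0, hs⟩, rfl⟩ (bddAbove_winCount G s)

/-- If `s ^ k ≤ t`, then `k` independent copies of the game over an alphabet of size `s` can be
played inside the game over an alphabet of size `t`. -/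
lemma maxWinCount_pow_le {V : Type*} [Finite V] (G : SimpleGraph V) {s t k : ℕ}
    (hs : 0 < s) (hk : s ^ k ≤ t) : maxWinCount G s ^ k ≤ maxWinCount G t := by
  obtain ⟨F, hF⟩ := exists_winCount_eq_maxWinCount G hs
  have : Nonempty (Fin s) := ⟨⟨0, hs⟩⟩
  obtain ⟨e⟩ : Nonempty ((Fin k → Fin s) ↪ Fin t) :=
    Function.Embedding.nonempty_of_card_le (by simpa using hk)
  have hr : ∀ x, Function.invFun e (e x) = x := Function.leftInverse_invFun e.injective
  let F' : GuessStrategy G (Fin t) := fun v x =>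
    e fun i => F v fun u => Function.invFun e (x u) i
  let φ : (Fin k → {a : V → Fin s // WinningAssignment F a}) →
      {a : V → Fin t // WinningAssignment F' a} := fun a =>
    ⟨fun v => e fun i => (a i).1 v, fun v => by
      simp only [F', hr]
      exact congrArg e (funext fun i => (a i).2 v)⟩
  have hφ : Function.Injective φ := fun a b h => by
    funext i
    refine Subtype.ext (funext fun v => ?_)
    exact congrFun (e.injective (congrFun (congrArg Subtype.val h) v)) i
  calc maxWinCount G s ^ k
      = Nat.card (Fin k → {a : V → Fin s // WinningAssignment F a}) := by
        rw [← hF, winCount, Nat.card_fun, Nat.card_fin]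
    _ ≤ winCount G t F' := Nat.card_le_card_of_injective φ hφ
    _ ≤ maxWinCount G t := le_csSup (bddAbove_winCount G t) ⟨F', rfl⟩

/-- For a finite simple graph G and integers t ≥ s ≥ 2,
gn(G,t) ≥ (⌊log_s t⌋ / log_s t) · gn(G,s). -/
theorem gn_almost_monotone {V : Type*} [Fintype V] (G : SimpleGraph V)
    (s t : ℕ) (hs : 2 ≤ s) (hst : s ≤ t) :
    ((⌊Real.logb s t⌋₊ : ℝ) / Real.logb s t) * gn G s ≤ gn G t := by
  have hs1 : (1 : ℝ) < s := by exact_mod_cast hs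
  have ht1 : (1 : ℝ) < t := by exact_mod_cast hs.trans hst
  have hls := Real.log_pos hs1
  have hlt := Real.log_pos ht1
  have hk : s ^ ⌊Real.logb s t⌋₊ ≤ t := by
    have h := Nat.floor_le (Real.logb_nonneg hs1 ht1.le)
    rw [Real.le_logb_iff_rpow_le hs1 (by positivity), Real.rpow_natCast] at h
    exact_mod_cast h
  have hN := maxWinCount_pow_le G (by omega) hk
  generalize ⌊Real.logb s t⌋₊ = k at hN ⊢
  have hlog : k * Real.log (maxWinCount G s) ≤ Real.log (maxWinCount G t) := by
    rcases Nat.eq_zero_or_pos (maxWinCount G s) with h0 | h0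
    · simpa [h0] using Real.log_natCast_nonneg (maxWinCount G t)
    · rw [← Real.log_pow]
      exact Real.log_le_log (by positivity) (by exact_mod_cast hN)
  calc (k : ℝ) / Real.logb s t * gn G s
      = k * Real.log (maxWinCount G s) / Real.log t := by
        simp only [gn, Real.logb]
        field_simp
    _ ≤ gn G t := by
        simp only [gn, Real.logb]
        gcongr
end

section
/- For every finite simple graph G on n vertices, the limit superior as s → ∞ of the guessing numbers gn(G,s) is at least n − κ_f(G); moreover, there exist an integer s ≥ 2 and a guessing strategy F for (G,s) such that log_s of the number of assignments won by F equals n − κ_f(G). -/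
open Finset

/-- A fractional clique cover of `G`: a weighting `w : Finset V → ℝ` taking values
in `[0,1]`, supported on cliques of `G`, such that for every vertex `v` the total
weight of the cliques containing `v` is at least `1`. -/
def IsFracCliqueCover {V : Type*} [Fintype V] [DecidableEq V]
    (G : SimpleGraph V) (w : Finset V → ℝ) : Prop :=
  (∀ k : Finset V, 0 ≤ w k ∧ w k ≤ 1) ∧
    (∀ k : Finset V, ¬ G.IsClique (k : Set V) → w k = 0) ∧
    ∀ v : V, 1 ≤ ∑ k ∈ Finset.univ.filter (fun k : Finset V => v ∈ k), w k

/-- A fractional clique cover is regular if for every vertex the total weight of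
the cliques containing it is exactly `1`. -/
def IsRegularFracCliqueCover {V : Type*} [Fintype V] [DecidableEq V]
    (G : SimpleGraph V) (w : Finset V → ℝ) : Prop :=
  IsFracCliqueCover G w ∧
    ∀ v : V, ∑ k ∈ Finset.univ.filter (fun k : Finset V => v ∈ k), w k = 1

/-- The fractional clique cover number `κ_f(G)`: the infimum of the total weight
over all fractional clique covers of `G`. -/
noncomputable def fracCliqueCoverNum {V : Type*} [Fintype V] [DecidableEq V]
    (G : SimpleGraph V) : ℝ :=
  sInf {x | ∃ w : Finset V → ℝ, IsFracCliqueCover G w ∧ x = ∑ k : Finset V, w k}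

theorem eventually_le_add_mul {x y c : ℝ} (h : c ≤ x) (hy : x = c → y = 0) :
    ∀ᶠ t in nhds (0 : ℝ), c ≤ x + t * y := by
  rcases h.eq_or_lt with h | h
  · exact Filter.Eventually.of_forall fun t => by simp [hy h.symm, h]
  · have hc : Filter.Tendsto (fun t : ℝ => x + t * y) (nhds 0) (nhds x) := by
      have : Continuous fun t : ℝ => x + t * y := by fun_prop
      simpa using this.tendsto 0
    exact (hc.eventually (lt_mem_nhds h)).mono fun _ ht => ht.le

theorem exists_ratLinear_of_irrational {x : ℝ} (hx : Irrational x) :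
    ∃ φ : ℝ →ₗ[ℚ] ℚ, φ 1 = 0 ∧ φ x ≠ 0 := by
  have hmem : x ∉ Submodule.span ℚ {(1 : ℝ)} := by
    rw [Submodule.mem_span_singleton]
    rintro ⟨r, hr⟩
    exact hx ⟨r, by simpa [Rat.smul_def] using hr⟩
  obtain ⟨φ, hφ, hle⟩ := Submodule.exists_le_ker_of_notMem hmem
  exact ⟨φ, hle (Submodule.mem_span_singleton_self 1), hφ⟩

section Cover

variable {V : Type*} [Fintype V] [DecidableEq V] {G : SimpleGraph V}

theorem IsFracCliqueCover.eventually_add_smul {w : Finset V → ℝ} (hw : IsFracCliqueCover G w)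
    (φ : ℝ →ₗ[ℚ] ℚ) (hφ : φ 1 = 0) :
    ∀ᶠ t in nhds (0 : ℝ), IsFracCliqueCover G (fun k => w k + t * (φ (w k) : ℝ)) := by
  obtain ⟨hbd, hcl, hcov⟩ := hw
  have h0 : ∀ᶠ t in nhds (0 : ℝ), ∀ k, 0 ≤ w k + t * (φ (w k) : ℝ) :=
    Filter.eventually_all.2 fun k =>
      eventually_le_add_mul (hbd k).1 fun h => by simp [h]
  have h1 : ∀ᶠ t in nhds (0 : ℝ), ∀ k, -1 ≤ -w k + t * (-(φ (w k) : ℝ)) :=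
    Filter.eventually_all.2 fun k =>
      eventually_le_add_mul (neg_le_neg (hbd k).2) fun h => by simp [neg_injective h, hφ]
  have h2 : ∀ᶠ t in nhds (0 : ℝ), ∀ v,
      1 ≤ ∑ k ∈ univ.filter (fun k : Finset V => v ∈ k), w k +
        t * ((φ (∑ k ∈ univ.filter (fun k : Finset V => v ∈ k), w k) : ℚ) : ℝ) :=
    Filter.eventually_all.2 fun v =>
      eventually_le_add_mul (hcov v) fun h => by simp [h, hφ]
  filter_upwards [h0, h1, h2] with t h0 h1 h2
  refine ⟨fun k => ⟨h0 k, by linarith [h1 k]⟩, fun k hk => by simp [hcl k hk], fun v => ?_⟩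
  have := h2 v
  rwa [map_sum, Rat.cast_sum, Finset.mul_sum, ← Finset.sum_add_distrib] at this

theorem isFracCliqueCover_nonempty (G : SimpleGraph V) : {w | IsFracCliqueCover G w}.Nonempty := by
  classical
  refine ⟨fun k => if G.IsClique (k : Set V) then 1 else 0, fun k => ?_, fun k hk => if_neg hk,
    fun v => ?_⟩
  · dsimp only
    split_ifs <;> norm_num
  · refine le_trans ?_ (Finset.single_le_sum (a := {v}) (fun k _ => ?_) (by simp))
    · simp
    · split_ifs <;> norm_num

theorem isCompact_isFracCliqueCover (G : SimpleGraph V) :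
    IsCompact {w | IsFracCliqueCover G w} := by
  refine (isCompact_Icc (a := (0 : Finset V → ℝ)) (b := 1)).of_isClosed_subset ?_
    fun w hw => ⟨fun k => (hw.1 k).1, fun k => (hw.1 k).2⟩
  simp only [IsFracCliqueCover, Set.ofPred_and, Set.ofPred_forall]
  refine IsClosed.inter ?_ (IsClosed.inter ?_ ?_)
  · exact isClosed_iInter fun k => (isClosed_le (by fun_prop) (by fun_prop)).inter
      (isClosed_le (by fun_prop) (by fun_prop))
  · exact isClosed_iInter fun k => isClosed_iInter fun _ =>
      isClosed_eq (by fun_prop) (by fun_prop)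
  · exact isClosed_iInter fun v => isClosed_le (by fun_prop) (by fun_prop)

theorem IsFracCliqueCover.fracCliqueCoverNum_le {w : Finset V → ℝ} (hw : IsFracCliqueCover G w) :
    fracCliqueCoverNum G ≤ ∑ k, w k := by
  refine csInf_le ⟨0, ?_⟩ ⟨w, hw, rfl⟩
  rintro x ⟨w, hw, rfl⟩
  exact Finset.sum_nonneg fun k _ => (hw.1 k).1

theorem exists_sum_eq_fracCliqueCoverNum (G : SimpleGraph V) :
    ∃ w, IsFracCliqueCover G w ∧ ∑ k, w k = fracCliqueCoverNum G := by
  obtain ⟨w, hw, hmin⟩ := (isCompact_isFracCliqueCover G).exists_isMinOn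
    (isFracCliqueCover_nonempty G) (f := fun w => ∑ k, w k)
    (by fun_prop : Continuous fun w : Finset V → ℝ => ∑ k, w k).continuousOn
  refine ⟨w, hw, le_antisymm (le_csInf ⟨_, w, hw, rfl⟩ ?_) hw.fracCliqueCoverNum_le⟩
  rintro x ⟨w', hw', rfl⟩
  exact hmin hw'

/-- The clique cover linear program has an optimal solution with rational weights: an extreme
point of the set of optimal solutions is rational, since otherwise it could be perturbed in the
direction given by a `ℚ`-linear functional vanishing on `ℚ`. -/
theorem exists_rat_sum_eq_fracCliqueCoverNum (G : SimpleGraph V) :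
    ∃ r : Finset V → ℚ, IsFracCliqueCover G (fun k => (r k : ℝ)) ∧
      ∑ k, (r k : ℝ) = fracCliqueCoverNum G := by
  let O : Set (Finset V → ℝ) :=
    {w | IsFracCliqueCover G w} ∩ {w | ∑ k, w k = fracCliqueCoverNum G}
  have hO : IsCompact O := (isCompact_isFracCliqueCover G).inter_right
    (isClosed_eq (by fun_prop) (by fun_prop))
  obtain ⟨w, hw⟩ := hO.extremePoints_nonempty (exists_sum_eq_fracCliqueCoverNum G)
  have hrat : ∀ k, ∃ r : ℚ, (r : ℝ) = w k := by
    by_contra! hk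
    obtain ⟨k, hk⟩ := hk
    obtain ⟨φ, hφ1, hφ⟩ := exists_ratLinear_of_irrational (x := w k) fun ⟨r, hr⟩ => hk r hr
    obtain ⟨⟨hwc, hws⟩, hext⟩ := mem_extremePoints.1 hw
    obtain ⟨ε, hε, hball⟩ := Metric.eventually_nhds_iff.1 (hwc.eventually_add_smul φ hφ1)
    have hp := hball (y := ε / 2) (by rw [Real.dist_eq, sub_zero, abs_of_pos] <;> linarith)
    have hm := hball (y := -(ε / 2))
      (by rw [Real.dist_eq, sub_zero, abs_neg, abs_of_pos] <;> linarith)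
    have hp' := hp.fracCliqueCoverNum_le
    have hm' := hm.fracCliqueCoverNum_le
    rw [Finset.sum_add_distrib, ← Finset.mul_sum, hws] at hp' hm'
    have hsp : ∑ k, (w k + ε / 2 * (φ (w k) : ℝ)) = fracCliqueCoverNum G := by
      rw [Finset.sum_add_distrib, ← Finset.mul_sum, hws]
      linarith
    have hsm : ∑ k, (w k + -(ε / 2) * (φ (w k) : ℝ)) = fracCliqueCoverNum G := by
      rw [Finset.sum_add_distrib, ← Finset.mul_sum, hws]
      linarith
    have hseg : w ∈ openSegment ℝ (fun k => w k + ε / 2 * (φ (w k) : ℝ))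
        (fun k => w k + -(ε / 2) * (φ (w k) : ℝ)) := by
      refine ⟨1 / 2, 1 / 2, by norm_num, by norm_num, by norm_num, funext fun k => ?_⟩
      simp only [Pi.add_apply, Pi.smul_apply, smul_eq_mul]
      ring
    have := congrFun (hext _ ⟨hp, hsp⟩ _ ⟨hm, hsm⟩ hseg).1 k
    have hne : (φ (w k) : ℝ) ≠ 0 := by exact_mod_cast hφ
    have : ε / 2 * (φ (w k) : ℝ) = 0 := by linarith
    rcases mul_eq_zero.1 this with h | h
    · linarith
    · exact hne h
  choose r hr using hrat
  obtain rfl : (fun k => (r k : ℝ)) = w := funext hr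
  exact ⟨r, hw.1.1, hw.1.2⟩

end Cover

theorem exists_common_denom {ι : Type*} [Fintype ι] (r : ι → ℚ) (hr : ∀ i, 0 ≤ r i) :
    ∃ q : ℕ, 0 < q ∧ ∃ p : ι → ℕ, ∀ i, (r i : ℝ) * q = p i := by
  refine ⟨∏ i, (r i).den, Finset.prod_pos fun i _ => (r i).den_pos, ?_⟩
  have : ∀ i, ∃ p : ℕ, (r i : ℝ) * (∏ i, (r i).den : ℕ) = p := fun i => by
    obtain ⟨c, hc⟩ := Finset.dvd_prod_of_mem (fun i => (r i).den) (Finset.mem_univ i)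
    refine ⟨(r i).num.toNat * c, ?_⟩
    have hnum : (((r i).num.toNat : ℕ) : ℚ) = r i * (r i).den := by
      rw [Rat.mul_den_eq_num]
      exact_mod_cast Int.toNat_of_nonneg (Rat.num_nonneg.2 (hr i))
    have hnum' : (((r i).num.toNat : ℕ) : ℝ) = r i * (r i).den := by exact_mod_cast hnum
    rw [hc]
    push_cast
    rw [hnum']
    ring
  choose p hp using this
  exact ⟨p, hp⟩

/-- A labelling of the `q`-fold copies of the vertices of `G`, each of whose classes consists of
copies of pairwise distinct and adjacent vertices. -/
structure IsCliqueLabelling {V I : Type*} (G : SimpleGraph V) {q : ℕ} (E : V × Fin q → I) :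
    Prop where
  surjective : Function.Surjective E
  adj : ∀ p p' : V × Fin q, E p = E p' → p ≠ p' → G.Adj p.1 p'.1

theorem IsCliqueLabelling.injective {V I : Type*} {G : SimpleGraph V} {q : ℕ} {E : V × Fin q → I}
    (hE : IsCliqueLabelling G E) (v : V) : Function.Injective fun j => E (v, j) := fun j j' h => by
  by_contra hj
  exact G.irrefl (hE.adj (v, j) (v, j') h (by simpa using hj))

section Labelling

variable {V I : Type*} [Fintype V] [DecidableEq V] [Fintype I] [DecidableEq I]
  {G : SimpleGraph V} {q : ℕ} {E : V × Fin q → I}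

/-- A clique labelling with `q` copies of each vertex gives a fractional clique cover in which
every label contributes `1 / q`. -/
theorem IsCliqueLabelling.mul_fracCliqueCoverNum_le (hE : IsCliqueLabelling G E) (hq : 0 < q) :
    q * fracCliqueCoverNum G ≤ Fintype.card I := by
  classical
  have hq' : (0 : ℝ) < q := by exact_mod_cast hq
  let S : I → Finset V := fun i => univ.filter fun v => ∃ j, E (v, j) = i
  have hcard : ∀ v, #{i | v ∈ S i} = q := fun v => by
    have : ({i | v ∈ S i} : Finset I) = univ.image fun j => E (v, j) := by
      ext i
      simp [S]
    rw [this, Finset.card_image_of_injective _ (hE.injective v), Finset.card_univ,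
      Fintype.card_fin]
  have hw : IsFracCliqueCover G (fun k => (#{i | S i = k} : ℝ) / q) := by
    refine ⟨fun k => ⟨by positivity, ?_⟩, fun k hk => ?_, fun v => ?_⟩
    · rw [div_le_one hq']
      norm_cast
      rcases Finset.eq_empty_or_nonempty ({i | S i = k} : Finset I) with h | ⟨i, hi⟩
      · simp [h]
      · obtain ⟨⟨v, j⟩, rfl⟩ := hE.surjective i
        have hv : v ∈ k := by
          rw [← (Finset.mem_filter.1 hi).2]
          simp only [S, Finset.mem_filter, Finset.mem_univ, true_and]
          exact ⟨j, rfl⟩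
        rw [← hcard v]
        refine Finset.card_le_card fun i hi => ?_
        rw [Finset.mem_filter] at hi ⊢
        exact ⟨hi.1, hi.2 ▸ hv⟩
    · have : ({i | S i = k} : Finset I) = ∅ := by
        refine Finset.filter_eq_empty_iff.2 fun i _ hi => hk ?_
        intro u hu v hv huv
        rw [← hi] at hu hv
        obtain ⟨j, hj⟩ := (Finset.mem_filter.1 hu).2
        obtain ⟨j', hj'⟩ := (Finset.mem_filter.1 hv).2
        exact hE.adj (u, j) (v, j') (hj.trans hj'.symm) fun h => huv (congrArg Prod.fst h)
      simp [this]
    · rw [← Finset.sum_div, le_div_iff₀ hq', one_mul]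
      norm_cast
      rw [← hcard v, Finset.card_eq_sum_card_fiberwise (f := S)
        (t := univ.filter fun k : Finset V => v ∈ k) (fun i hi => by simpa using hi)]
      exact Finset.sum_le_sum fun k _ =>
        Finset.card_le_card (Finset.filter_subset_filter _ (Finset.filter_subset _ _))
  have h := hw.fracCliqueCoverNum_le
  rw [← Finset.sum_div, le_div_iff₀ hq', ← Nat.cast_sum,
    ← Finset.card_eq_sum_card_fiberwise (fun i _ => by simp), Finset.card_univ] at h
  linarith

end Labelling

theorem exists_isCliqueLabelling {V : Type*} [Fintype V] [DecidableEq V] (G : SimpleGraph V) :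
    ∃ q : ℕ, 0 < q ∧ ∃ P : ℕ, (P : ℝ) = q * fracCliqueCoverNum G ∧
      ∃ E : V × Fin q → Fin P, IsCliqueLabelling G E := by
  classical
  obtain ⟨r, hr, hsum⟩ := exists_rat_sum_eq_fracCliqueCoverNum G
  obtain ⟨q, hq, p, hp⟩ := exists_common_denom r fun k => Rat.cast_nonneg.1 (hr.1 k).1
  have hq' : (0 : ℝ) < q := by exact_mod_cast hq
  have hemb : ∀ v, Nonempty (Fin q ↪ Σ k : {k : Finset V // v ∈ k}, Fin (p k)) := fun v => by
    refine Function.Embedding.nonempty_of_card_le ?_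
    rw [Fintype.card_fin, Fintype.card_sigma]
    simp only [Fintype.card_fin]
    have h := mul_le_mul_of_nonneg_right (hr.2.2 v) hq'.le
    rw [Finset.sum_mul, one_mul, Finset.sum_congr rfl fun k _ => hp k] at h
    rw [← Finset.sum_subtype (univ.filter fun k : Finset V => v ∈ k) (by simp) p]
    exact_mod_cast h
  let f := fun v => (hemb v).some
  let E : V × Fin q → Σ k : Finset V, Fin (p k) :=
    fun x => ⟨(f x.1 x.2).1, (f x.1 x.2).2⟩
  have hmem : ∀ x, x.1 ∈ (E x).1 := fun x => (f x.1 x.2).1.2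
  have hinj : ∀ v j j', E (v, j) = E (v, j') → j = j' := fun v j j' h => by
    refine (f v).injective ?_
    simp only [E] at h
    generalize f v j = a at h
    generalize f v j' = b at h
    obtain ⟨⟨a, ha⟩, a'⟩ := a
    obtain ⟨⟨b, hb⟩, b'⟩ := b
    simp only [Sigma.mk.injEq] at h
    obtain ⟨rfl, h⟩ := h
    rw [eq_of_heq h]
  have hE : IsCliqueLabelling G (Set.rangeFactorization E) := by
    refine ⟨Set.rangeFactorization_surjective, ?_⟩
    rintro ⟨v, j⟩ ⟨v', j'⟩ h hne
    have h : E (v, j) = E (v', j') := congrArg Subtype.val h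
    have hclique : G.IsClique ((E (v, j)).1 : Set V) := by
      by_contra hk
      have h0 := hp (E (v, j)).1
      have hz : ((r (E (v, j)).1 : ℚ) : ℝ) = 0 := hr.2.1 _ hk
      rw [hz, zero_mul] at h0
      have : p (E (v, j)).1 = 0 := by exact_mod_cast h0.symm
      have hlt := (E (v, j)).2.isLt
      omega
    refine hclique (hmem (v, j)) (h ▸ hmem (v', j')) fun hv => hne ?_
    dsimp only at hv
    subst hv
    rw [hinj _ _ _ h]
  have hle := hE.mul_fracCliqueCoverNum_le hq
  have hge : (Fintype.card (Set.range E) : ℝ) ≤ q * fracCliqueCoverNum G := by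
    have h := Fintype.card_le_of_injective _ (Subtype.val_injective (p := (· ∈ Set.range E)))
    rw [Fintype.card_sigma] at h
    simp only [Fintype.card_fin] at h
    rw [← hsum, mul_comm, Finset.sum_mul, Finset.sum_congr rfl fun k _ => hp k]
    exact_mod_cast h
  let e := Fintype.equivFin (Set.range E)
  refine ⟨q, hq, _, le_antisymm hge hle, e ∘ Set.rangeFactorization E,
    e.surjective.comp hE.surjective, fun x y h => hE.adj x y (e.injective h)⟩

section Strategy

variable {V I : Type*} [Fintype V] [DecidableEq V] [Fintype I] [DecidableEq I]

/-- Summing over the fibres of a surjection is a surjective homomorphism, which determines the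
size of its kernel. -/
theorem card_fiberSum_eq_zero {X : Type*} [Fintype X] {E : X → I}
    (hE : Function.Surjective E) (m : ℕ) [NeZero m] :
    Nat.card {a : X → ZMod m // ∀ i, ∑ x with E x = i, a x = 0} * m ^ Fintype.card I =
      m ^ Fintype.card X := by
  classical
  let T : (X → ZMod m) →+ (I → ZMod m) :=
    { toFun := fun a i => ∑ x with E x = i, a x
      map_zero' := by ext; simp
      map_add' := fun a b => by ext; simp [Finset.sum_add_distrib] }
  have hT : Function.Surjective T := fun y => by
    refine ⟨fun x => if x = Function.surjInv hE (E x) then y (E x) else 0, funext fun i => ?_⟩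
    change ∑ x with E x = i, (if x = Function.surjInv hE (E x) then y (E x) else 0) = y i
    rw [Finset.sum_eq_single (Function.surjInv hE i)]
    · simp [Function.surjInv_eq]
    · intro x hx hne
      rw [Finset.mem_filter] at hx
      rw [hx.2, if_neg hne]
    · simp [Function.surjInv_eq]
  have h := T.ker.card_mul_index
  rw [AddSubgroup.index_ker, AddMonoidHom.range_eq_top.2 hT] at h
  have hker : Nat.card T.ker = Nat.card {a : X → ZMod m // ∀ i, ∑ x with E x = i, a x = 0} :=
    Nat.card_congr (Equiv.subtypeEquivRight fun a => by
      rw [AddMonoidHom.mem_ker, funext_iff]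
      rfl)
  rw [hker] at h
  simpa [Nat.card_eq_fintype_card, ZMod.card] using h

variable {G : SimpleGraph V} {q : ℕ} {E : V × Fin q → I}

/-- Every copy of a vertex guesses that the values in its label class sum to zero. -/
theorem IsCliqueLabelling.exists_strategy (hE : IsCliqueLabelling G E) (m : ℕ) [NeZero m] :
    ∃ F : GuessStrategy G (Fin (m ^ q)),
      winCount G (m ^ q) F * m ^ Fintype.card I = m ^ (Fintype.card V * q) := by
  classical
  let c : Fin (m ^ q) ≃ (Fin q → ZMod m) :=
    Fintype.equivOfCardEq (by simp [ZMod.card])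
  let F : GuessStrategy G (Fin (m ^ q)) := fun v x => c.symm fun j =>
    -∑ p with E p = E (v, j), if h : G.Adj v p.1 then c (x ⟨p.1, h⟩) p.2 else 0
  refine ⟨F, ?_⟩
  let d : (V → Fin (m ^ q)) ≃ (V × Fin q → ZMod m) :=
    (Equiv.piCongrRight fun _ => c).trans (Equiv.curry V (Fin q) (ZMod m)).symm
  have hd : ∀ a v j, d a (v, j) = c (a v) j := fun _ _ _ => rfl
  have hguess : ∀ a v j, ∑ p with E p = E (v, j),
      (if G.Adj v p.1 then c (a p.1) p.2 else 0) =
        ∑ p with E p = E (v, j), d a p - c (a v) j := fun a v j => by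
    have hmem : (v, j) ∈ ({p | E p = E (v, j)} : Finset (V × Fin q)) := by simp
    rw [← Finset.add_sum_erase _ _ hmem, ← Finset.add_sum_erase _ (d a) hmem, hd,
      add_sub_cancel_left, if_neg (G.irrefl), zero_add]
    refine Finset.sum_congr rfl fun p hp => ?_
    rw [Finset.mem_erase, Finset.mem_filter] at hp
    rw [if_pos (hE.adj (v, j) p hp.2.2.symm hp.1.symm)]
    rfl
  have hwin : ∀ a, WinningAssignment F a ↔ ∀ i, ∑ x with E x = i, d a x = 0 := fun a => by
    have : WinningAssignment F a ↔ ∀ v j, ∑ p with E p = E (v, j), d a p = 0 := by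
      refine forall_congr' fun v => ?_
      rw [Equiv.symm_apply_eq, funext_iff]
      refine forall_congr' fun j => ?_
      simp only [dite_eq_ite]
      rw [hguess, neg_sub, sub_eq_self]
    rw [this, hE.surjective.forall, Prod.forall]
  rw [winCount,
    Nat.card_congr (d.subtypeEquiv (q := fun b => ∀ i, ∑ x with E x = i, b x = 0) hwin),
    card_fiberSum_eq_zero hE.surjective, Fintype.card_prod, Fintype.card_fin]

theorem IsCliqueLabelling.exists_logb_winCount (hE : IsCliqueLabelling G E) (hq : 0 < q)
    {m : ℕ} (hm : 2 ≤ m) :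
    ∃ F : GuessStrategy G (Fin (m ^ q)),
      Real.logb (m ^ q : ℕ) (winCount G (m ^ q) F) =
        (Fintype.card V : ℝ) - (Fintype.card I : ℝ) / q := by
  have : NeZero m := ⟨by omega⟩
  obtain ⟨F, hF⟩ := hE.exists_strategy m
  refine ⟨F, ?_⟩
  have hm0 : (0 : ℝ) < m := by positivity
  have hlog : 0 < Real.log m := Real.log_pos (by exact_mod_cast hm)
  have hq' : (0 : ℝ) < q := by exact_mod_cast hq
  have hne : (winCount G (m ^ q) F : ℝ) ≠ 0 := fun h => by
    rw [Nat.cast_eq_zero.1 h, zero_mul] at hF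
    exact absurd hF.symm (pow_ne_zero _ (by omega))
  have h := congrArg (fun n : ℕ => Real.log n) hF
  simp only [Nat.cast_mul, Nat.cast_pow] at h
  rw [Real.log_mul hne (by positivity), Real.log_pow, Real.log_pow] at h
  rw [Real.logb, Nat.cast_pow, Real.log_pow, eq_sub_of_add_eq h]
  push_cast
  field_simp

end Strategy

section MaxWinCount

variable {V : Type*} [Fintype V] (G : SimpleGraph V)

theorem winCount_le (s : ℕ) (F : GuessStrategy G (Fin s)) :
    winCount G s F ≤ s ^ Fintype.card V := by
  classical
  refine (Nat.card_le_card_of_injective _ Subtype.val_injective).trans ?_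
  simp

theorem winCount_le_maxWinCount (s : ℕ) (F : GuessStrategy G (Fin s)) :
    winCount G s F ≤ maxWinCount G s :=
  le_csSup ⟨_, by rintro _ ⟨F, rfl⟩; exact winCount_le G s F⟩ ⟨F, rfl⟩

theorem maxWinCount_le (s : ℕ) : maxWinCount G s ≤ s ^ Fintype.card V := by
  refine csSup_le' ?_
  rintro _ ⟨F, rfl⟩
  exact winCount_le G s F

theorem gn_le_card {s : ℕ} (hs : 2 ≤ s) : gn G s ≤ Fintype.card V := by
  have hs' : (1 : ℝ) < s := by exact_mod_cast hs
  rcases (maxWinCount G s).eq_zero_or_pos with h | h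
  · simp [gn, h]
  · rw [gn, Real.logb_le_iff_le_rpow hs' (by exact_mod_cast h), Real.rpow_natCast]
    exact_mod_cast maxWinCount_le G s

end MaxWinCount

/-- For every finite simple graph G on n vertices,
limsup_{s→∞} gn(G,s) ≥ n − κ_f(G); moreover there exist an alphabet size s ≥ 2 and a
guessing strategy F for (G,s) whose number of winning assignments N satisfies
log_s N = n − κ_f(G). -/
theorem limsup_gn_ge_card_sub_fracCliqueCoverNum {V : Type*} [Fintype V] [DecidableEq V]
    (G : SimpleGraph V) :
    (Fintype.card V : ℝ) - fracCliqueCoverNum G ≤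
        Filter.limsup (fun s : ℕ => gn G s) Filter.atTop ∧
      ∃ s : ℕ, 2 ≤ s ∧ ∃ F : GuessStrategy G (Fin s),
        Real.logb s (winCount G s F) = (Fintype.card V : ℝ) - fracCliqueCoverNum G := by
  obtain ⟨q, hq, P, hP, E, hE⟩ := exists_isCliqueLabelling G
  have hq' : (q : ℝ) ≠ 0 := by exact_mod_cast hq.ne'
  have key : ∀ m, 2 ≤ m → ∃ F : GuessStrategy G (Fin (m ^ q)),
      Real.logb (m ^ q : ℕ) (winCount G (m ^ q) F) =
        (Fintype.card V : ℝ) - fracCliqueCoverNum G := fun m hm => by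
    obtain ⟨F, hF⟩ := hE.exists_logb_winCount hq hm
    refine ⟨F, ?_⟩
    rw [hF, Fintype.card_fin, hP, mul_div_cancel_left₀ _ hq']
  refine ⟨?_, 2 ^ q, Nat.le_self_pow hq.ne' 2, key 2 le_rfl⟩
  refine Filter.le_limsup_of_frequently_le (Filter.frequently_atTop.2 fun N => ?_)
    (Filter.isBoundedUnder_of_eventually_le (a := (Fintype.card V : ℝ)) ?_)
  · have hm : 2 ≤ max N 2 := le_max_right _ _
    obtain ⟨F, hF⟩ := key _ hm
    have hpow := Nat.le_self_pow hq.ne' (max N 2)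
    refine ⟨max N 2 ^ q, (le_max_left _ _).trans hpow, ?_⟩
    rw [← hF, gn]
    have hs : (1 : ℝ) < (max N 2 ^ q : ℕ) := by exact_mod_cast hm.trans hpow
    rcases (winCount G _ F).eq_zero_or_pos with h | h
    · rw [h, Nat.cast_zero, Real.logb_zero]
      exact div_nonneg (Real.log_natCast_nonneg _) (Real.log_natCast_nonneg _)
    · exact Real.logb_le_logb_of_le hs (by exact_mod_cast h)
        (by exact_mod_cast winCount_le_maxWinCount G _ F)
  · filter_upwards [Filter.eventually_ge_atTop 2] with s hs using gn_le_card G hs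
end
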